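/- arXiv:2412.18058 — 3 statements merged into one kernel-verified Lean document; each statement's English description precedes it below -/
import Mathlib

section
/- Let n be a positive integer and let σ be a permutation of {1,…,n} whose cycle type is the partition α = (α_1 ≥ α_2 ≥ ⋯ ≥ α_r) of n. Then every decreasing subsequence of σ has length at most n − r + #{i : α_i = 2} + ε, where ε = 1 if α_r = 1 and ε = 0 otherwise. -/
open Equiv

/-- `s` is (the index set of) an increasing subsequence of the permutation `σ`. -/
def IsIncSubseq {n : ℕ} (σ : Perm (Fin n)) (s : Finset (Fin n)) : Prop :=
  ∀ i ∈ s, ∀ j ∈ s, i < j → σ i < σ j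

/-- `s` is (the index set of) a decreasing subsequence of the permutation `σ`. -/
def IsDecSubseq {n : ℕ} (σ : Perm (Fin n)) (s : Finset (Fin n)) : Prop :=
  ∀ i ∈ s, ∀ j ∈ s, i < j → σ j < σ i

/-- The cycle type of `σ`, counting each fixed point as a cycle of length `1`. -/
def fullCycleType {n : ℕ} (σ : Perm (Fin n)) : Multiset ℕ :=
  σ.cycleType + Multiset.replicate (n - σ.cycleType.sum) 1

/-- A decreasing subsequence that is mapped into itself is reversed by `σ`. -/
theorem IsDecSubseq.apply_apply_eq {n : ℕ} {σ : Perm (Fin n)} {s : Finset (Fin n)}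
    (hs : IsDecSubseq σ s) (hmaps : ∀ x ∈ s, σ x ∈ s) {x : Fin n} (hx : x ∈ s) :
    σ (σ x) = x := by
  let f : s → s := fun y => ⟨σ y, hmaps y y.2⟩
  have hf : StrictAnti f := fun a b hab => hs a a.2 b b.2 hab
  have hff : StrictMono (f ∘ f) := hf.comp hf
  exact congrArg Subtype.val (le_antisymm (hff.apply_le (x := ⟨x, hx⟩)) hff.le_apply)

theorem IsDecSubseq.mono {n : ℕ} {σ : Perm (Fin n)} {s t : Finset (Fin n)}
    (hs : IsDecSubseq σ s) (hts : t ⊆ s) : IsDecSubseq σ t :=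
  fun i hi j hj => hs i (hts hi) j (hts hj)

/-- A cycle of `σ` contained in a decreasing subsequence has length two. -/
theorem IsDecSubseq.card_support_eq_two {n : ℕ} {σ c : Perm (Fin n)} {s : Finset (Fin n)}
    (hs : IsDecSubseq σ s) (hc : c ∈ σ.cycleFactorsFinset) (hcs : c.support ⊆ s) :
    c.support.card = 2 := by
  obtain ⟨hcycle, happ⟩ := Perm.mem_cycleFactorsFinset_iff.mp hc
  have hmaps : ∀ x ∈ c.support, σ x ∈ c.support := fun x hx =>
    happ x hx ▸ Perm.apply_mem_support.mpr hx
  have hsq : c ^ 2 = 1 := by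
    ext x
    by_cases hx : x ∈ c.support
    · have h := (hs.mono hcs).apply_apply_eq hmaps hx
      rw [← happ x hx, ← happ (c x) (Perm.apply_mem_support.mpr hx)] at h
      simp [pow_two, h]
    · have h := Perm.notMem_support.mp hx
      simp [pow_two, h]
  have hle : c.support.card ≤ 2 := by
    rw [← hcycle.orderOf]
    exact orderOf_le_of_pow_eq_one two_pos hsq
  exact le_antisymm hle hcycle.two_le_card_support

/-- A decreasing subsequence contains at most one fixed point. -/
theorem IsDecSubseq.card_sdiff_support_le_one {n : ℕ} {σ : Perm (Fin n)} {s : Finset (Fin n)}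
    (hs : IsDecSubseq σ s) : (s \ σ.support).card ≤ 1 := by
  refine Finset.card_le_one.mpr fun a ha b hb => ?_
  simp only [Finset.mem_sdiff, Perm.notMem_support] at ha hb
  have hab := hs a ha.1 b hb.1
  have hba := hs b hb.1 a ha.1
  rw [ha.2, hb.2] at hab hba
  exact le_antisymm (not_lt.mp fun h => lt_asymm h (hba h)) (not_lt.mp fun h => lt_asymm h (hab h))

/-- Only cycles of length two can lie entirely inside a decreasing subsequence. -/
theorem IsDecSubseq.card_inter_support_add_card_cycleType_le {n : ℕ} {σ : Perm (Fin n)}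
    {s : Finset (Fin n)} (hs : IsDecSubseq σ s) :
    (s ∩ σ.support).card + Multiset.card σ.cycleType ≤
      σ.cycleType.sum + Multiset.count 2 σ.cycleType := by
  have hsub : s ∩ σ.support ⊆ σ.cycleFactorsFinset.biUnion fun c => s ∩ c.support := by
    intro x hx
    rw [Finset.mem_inter] at hx
    exact Finset.mem_biUnion.mpr ⟨σ.cycleOf x, Perm.cycleOf_mem_cycleFactorsFinset_iff.mpr hx.2,
      Finset.mem_inter.mpr ⟨hx.1, Perm.mem_support_cycleOf_iff.mpr ⟨Perm.SameCycle.refl σ x, hx.2⟩⟩⟩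
  have hcard := (Finset.card_le_card hsub).trans Finset.card_biUnion_le
  have hcycle : ∀ c ∈ σ.cycleFactorsFinset,
      (s ∩ c.support).card + 1 ≤ c.support.card + if 2 = c.support.card then 1 else 0 := by
    intro c hc
    by_cases hcs : c.support ⊆ s
    · rw [if_pos (hs.card_support_eq_two hc hcs).symm]
      gcongr
      exact Finset.inter_subset_right
    · refine le_add_right (Finset.card_lt_card ?_)
      exact Finset.ssubset_iff_subset_ne.mpr
        ⟨Finset.inter_subset_right, fun h => hcs (Finset.inter_eq_right.mp h)⟩
  have hsum := Finset.sum_le_sum hcycle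
  rw [Finset.sum_add_distrib, Finset.sum_add_distrib, Finset.sum_const, ← Finset.card_filter,
    smul_eq_mul, mul_one] at hsum
  have hcount : Multiset.count 2 σ.cycleType =
      (σ.cycleFactorsFinset.filter fun c => 2 = c.support.card).card := by
    rw [Perm.cycleType_def, Multiset.count_map]
    rfl
  have hlen : Multiset.card σ.cycleType = σ.cycleFactorsFinset.card := by
    rw [Perm.cycleType_def, Multiset.card_map]
    rfl
  have htotal : σ.cycleType.sum = ∑ c ∈ σ.cycleFactorsFinset, c.support.card := by
    rw [Perm.cycleType_def]
    rfl
  omega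

/-- Every decreasing subsequence of a permutation with cycle type `α`
(a partition of `n` with `r` parts) has length at most
`n - r + #{i : αᵢ = 2} + ε`, where `ε = 1` if `α` has a part equal to `1`
and `ε = 0` otherwise. -/
theorem decreasing_subsequence_bound (n : ℕ) (hn : 0 < n)
    (σ : Perm (Fin n)) (α : Multiset ℕ) (hα : fullCycleType σ = α)
    (s : Finset (Fin n)) (hs : IsDecSubseq σ s) :
    s.card ≤ n - Multiset.card α + Multiset.count 2 α +
      (if 1 ∈ α then 1 else 0) := by
  subst hα
  have hsplit := Finset.card_sdiff_add_card_inter s σ.support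
  have hfix := hs.card_sdiff_support_le_one
  have hmoved := hs.card_inter_support_add_card_cycleType_le
  have hsum : σ.cycleType.sum ≤ n := by
    simpa [Perm.sum_cycleType] using Finset.card_le_univ σ.support
  have hcard : Multiset.card (fullCycleType σ) =
      Multiset.card σ.cycleType + (n - σ.cycleType.sum) := by
    simp [fullCycleType]
  have hcount : Multiset.count 2 (fullCycleType σ) = Multiset.count 2 σ.cycleType := by
    simp [fullCycleType, Multiset.count_replicate]
  rw [hcard, hcount]
  split_ifs with hone
  · omega
  · have hfull : σ.support = Finset.univ := by
      refine Finset.eq_univ_of_card _ ?_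
      rw [← Perm.sum_cycleType, Fintype.card_fin]
      by_contra hne
      refine hone (Multiset.mem_add.mpr (Or.inr (Multiset.mem_replicate.mpr ⟨?_, rfl⟩)))
      omega
    have hempty : (s \ σ.support).card = 0 := by simp [hfull]
    omega
end

section
/- Let n be a positive integer and let σ be a permutation of {1,…,n} whose cycle type is the partition α = (α_1 ≥ α_2 ≥ ⋯ ≥ α_r) of n. Then every increasing subsequence of σ has length at most n − r + #{i : α_i = 1}. -/
open Equiv

/-- A permutation that is strictly increasing on a nonempty set invariant under it
fixes the maximum of that set. -/
theorem Equiv.Perm.exists_apply_eq_of_strictMonoOn {β : Type*} [LinearOrder β] (σ : Perm β)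
    (t : Finset β) (ht : t.Nonempty) (hinv : ∀ x, σ x ∈ t ↔ x ∈ t)
    (hσ : StrictMonoOn σ (t : Set β)) : ∃ x ∈ t, σ x = x := by
  have hm : t.max' ht ∈ t := t.max'_mem ht
  refine ⟨t.max' ht, hm, le_antisymm (t.le_max' _ ((hinv _).2 hm)) ?_⟩
  have hy : σ.symm (t.max' ht) ∈ t := (hinv _).1 (by simpa using hm)
  simpa using hσ.monotoneOn hy hm (t.le_max' _ hy)

/-- No nontrivial cycle of `σ` is contained in an increasing subsequence of `σ`. -/
theorem IsIncSubseq.exists_mem_support_notMem {n : ℕ} {σ : Perm (Fin n)} {s : Finset (Fin n)}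
    (hs : IsIncSubseq σ s) {c : Perm (Fin n)} (hc : c ∈ σ.cycleFactorsFinset) :
    ∃ x ∈ c.support, x ∉ s := by
  by_contra! hsub
  obtain ⟨hcyc, hcσ⟩ := Perm.mem_cycleFactorsFinset_iff.1 hc
  have hne : c.support.Nonempty := by
    rw [Finset.nonempty_iff_ne_empty, Ne, Perm.support_eq_empty_iff]
    exact hcyc.ne_one
  obtain ⟨x, hx, hfix⟩ := σ.exists_apply_eq_of_strictMonoOn c.support hne
    (fun x => Perm.mem_cycleFactorsFinset_support hc x)
    (fun a ha b hb hab => hs a (hsub a ha) b (hsub b hb) hab)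
  exact Perm.mem_support.1 hx ((hcσ x hx).trans hfix)

/-- The length of an increasing subsequence plus the number of nontrivial cycles is at most `n`. -/
theorem IsIncSubseq.card_add_card_cycleType_le {n : ℕ} {σ : Perm (Fin n)} {s : Finset (Fin n)}
    (hs : IsIncSubseq σ s) : s.card + Multiset.card σ.cycleType ≤ n := by
  have hex : ∀ c : σ.cycleFactorsFinset, ∃ x ∈ c.1.support, x ∉ s :=
    fun c => hs.exists_mem_support_notMem c.2
  choose f hf hfs using hex
  have hinj : Function.Injective f := by
    intro c d hcd
    by_contra hne
    have hdisj := σ.cycleFactorsFinset_pairwise_disjoint c.2 d.2 (fun h => hne (Subtype.ext h))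
    exact Finset.disjoint_left.1 hdisj.disjoint_support (hf c) (hcd ▸ hf d)
  have hcard : σ.cycleFactorsFinset.card ≤ sᶜ.card := by
    rw [← Fintype.card_coe σ.cycleFactorsFinset, ← Finset.card_univ]
    exact Finset.card_le_card_of_injOn f (fun c _ => by simpa using hfs c) hinj.injOn
  have hcompl := s.card_add_card_compl
  rw [Fintype.card_fin] at hcompl
  rw [Perm.cycleType_def, Multiset.card_map, Finset.card_val]
  lia

/-- Every increasing subsequence of a permutation with cycle type `α`
(a partition of `n` with `r` parts) has length at most
`n - r + #{i : αᵢ = 1}`. -/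
theorem increasing_subsequence_bound (n : ℕ) (hn : 0 < n)
    (σ : Perm (Fin n)) (α : Multiset ℕ) (hα : fullCycleType σ = α)
    (s : Finset (Fin n)) (hs : IsIncSubseq σ s) :
    s.card ≤ n - Multiset.card α + Multiset.count 1 α := by
  subst hα
  have hbound := hs.card_add_card_cycleType_le
  have hcount : Multiset.count 1 σ.cycleType = 0 :=
    Multiset.count_eq_zero.2 fun h => absurd (Perm.two_le_of_mem_cycleType h) (by norm_num)
  simp only [fullCycleType, Multiset.card_add, Multiset.card_replicate, Multiset.count_add,
    Multiset.count_replicate_self, hcount]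
  lia
end

section
/- Let n = 2m with m ≥ 3 odd. Define σ ∈ S_n by σ(i) = n − i for 1 ≤ i ≤ m−1, σ(m) = 1, σ(m+1) = n, and σ(i) = n + 2 − i for m+2 ≤ i ≤ n (in one-line notation, σ = [n−1, n−2, …, m+1, 1, n, m, m−1, …, 2]). Then σ is a product of two disjoint cycles each of length m (so σ has cycle type (m, m)), the longest increasing subsequence of σ has length 2, and the longest decreasing subsequence of σ has length n−2. -/
open Equiv

/-- The one-line notation `[n-1, n-2, …, m+1, 1, n, m, m-1, …, 2]` for `n = 2m`, with positions and
values shifted to start from `0`. -/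
def oneLine (m k : ℕ) : ℕ :=
  if k + 1 < m then 2 * m - 2 - k
  else if k + 1 = m then 0
  else if k = m then 2 * m - 1
  else 2 * m - k

lemma oneLine_lt {m k : ℕ} (hm : 3 ≤ m) (hk : k < 2 * m) : oneLine m k < 2 * m := by
  unfold oneLine
  split_ifs <;> omega

lemma oneLine_inj {m k l : ℕ} (hm : 3 ≤ m) (hk : k < 2 * m) (hl : l < 2 * m)
    (h : oneLine m k = oneLine m l) : k = l := by
  unfold oneLine at h
  split_ifs at h <;> omega

lemma oneLine_mod_two {m k : ℕ} (hm : 3 ≤ m) (hodd : Odd m) (hk : k < 2 * m) :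
    oneLine m k % 2 = k % 2 := by
  obtain ⟨t, rfl⟩ := hodd
  unfold oneLine
  split_ifs <;> omega

lemma oneLine_oneLine_of_add_lt {m k : ℕ} (hk : k + 2 < m) :
    oneLine m (oneLine m k) = k + 2 := by
  unfold oneLine
  split_ifs <;> omega

lemma oneLine_oneLine_of_lt {m k : ℕ} (hk : m + 1 < k) (hk' : k < 2 * m) :
    oneLine m (oneLine m k) = k - 2 := by
  unfold oneLine
  split_ifs <;> omega

lemma oneLine_oneLine_self {m : ℕ} (hm : 3 ≤ m) : oneLine m (oneLine m m) = 1 := by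
  unfold oneLine
  split_ifs <;> omega

lemma oneLine_oneLine_add_one {m : ℕ} (hm : 3 ≤ m) :
    oneLine m (oneLine m (m + 1)) = 0 := by
  unfold oneLine
  split_ifs <;> omega

lemma oneLine_lt_oneLine_iff {m k l : ℕ} (hm : 3 ≤ m) (hkl : k < l) (hl : l < 2 * m) :
    oneLine m k < oneLine m l ↔ k + 1 = m ∨ l = m := by
  unfold oneLine
  split_ifs <;> omega

/-- The permutation of `Fin (2 * m)` with one-line notation `oneLine m`. -/
noncomputable def oneLinePerm (m : ℕ) (hm : 3 ≤ m) : Perm (Fin (2 * m)) :=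
  Equiv.ofBijective (fun i => ⟨oneLine m i, oneLine_lt hm i.2⟩)
    (Finite.injective_iff_bijective.1 fun i j h =>
      Fin.ext (oneLine_inj hm i.2 j.2 (congrArg Fin.val h)))

section oneLinePerm

variable {m : ℕ} (hm : 3 ≤ m)

lemma oneLinePerm_val (i : Fin (2 * m)) : (oneLinePerm m hm i : ℕ) = oneLine m i := rfl

lemma oneLinePerm_sameCycle_of_oneLine_oneLine {i j : Fin (2 * m)}
    (h : oneLine m (oneLine m i) = j) : (oneLinePerm m hm).SameCycle i j :=
  ⟨2, Fin.ext h⟩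

lemma oneLinePerm_sameCycle_mod_two (hodd : Odd m) (k : ℕ) (hk : k < 2 * m) :
    (oneLinePerm m hm).SameCycle ⟨k, hk⟩ ⟨k % 2, by omega⟩ := by
  induction k using Nat.strong_induction_on with
  | _ k ih =>
    rcases Nat.lt_or_ge k 2 with h2 | h2
    · simp only [Nat.mod_eq_of_lt h2]
      exact Perm.SameCycle.refl _ _
    by_cases h : k = m ∨ k = m + 1
    · refine oneLinePerm_sameCycle_of_oneLine_oneLine hm ?_
      rcases h with rfl | rfl
      · exact (oneLine_oneLine_self hm).trans (Nat.odd_iff.1 hodd).symm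
      · rw [oneLine_oneLine_add_one hm]
        obtain ⟨t, rfl⟩ := hodd
        simp only
        omega
    · have hred : (oneLinePerm m hm).SameCycle ⟨k, hk⟩ ⟨k - 2, by omega⟩ := by
        rcases Nat.lt_or_ge k m with hlt | hge
        · refine (oneLinePerm_sameCycle_of_oneLine_oneLine hm ?_).symm
          rw [oneLine_oneLine_of_add_lt (by simp only; omega)]
          simp only
          omega
        · exact oneLinePerm_sameCycle_of_oneLine_oneLine hm
            (oneLine_oneLine_of_lt (by simp only; omega) hk)
      have := hred.trans (ih (k - 2) (by omega) (by omega))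
      simpa only [show (k - 2) % 2 = k % 2 by omega] using this

lemma oneLinePerm_sameCycle_iff (hodd : Odd m) (i j : Fin (2 * m)) :
    (oneLinePerm m hm).SameCycle i j ↔ (i : ℕ) % 2 = (j : ℕ) % 2 := by
  constructor
  · intro h
    obtain ⟨t, -, rfl⟩ := h.exists_pow_eq'
    clear h
    induction t with
    | zero => rfl
    | succ t ih =>
      rw [ih, pow_succ', Perm.mul_apply, oneLinePerm_val, oneLine_mod_two hm hodd (Fin.is_lt _)]
  · intro h
    have hi := oneLinePerm_sameCycle_mod_two hm hodd i i.2
    have hj := oneLinePerm_sameCycle_mod_two hm hodd j j.2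
    simp only [h] at hi
    exact hi.trans hj.symm

lemma card_filter_val_mod_two_eq (m r : ℕ) (hr : r < 2) :
    (Finset.univ.filter fun i : Fin (2 * m) => (i : ℕ) % 2 = r).card = m := by
  have : (Finset.univ.filter fun i : Fin (2 * m) => (i : ℕ) % 2 = r) =
      Finset.univ.image fun k : Fin m => (⟨2 * k + r, by omega⟩ : Fin (2 * m)) := by
    ext i
    simp only [Finset.mem_filter, Finset.mem_univ, true_and, Finset.mem_image, Fin.ext_iff]
    exact ⟨fun h => ⟨⟨i / 2, by omega⟩, by simp only; omega⟩, by rintro ⟨k, hk⟩; omega⟩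
  rw [this, Finset.card_image_of_injective _ fun k l h => by
    simp only [Fin.mk.injEq] at h; omega, Finset.card_univ, Fintype.card_fin]

lemma oneLinePerm_apply_ne (i : Fin (2 * m)) : oneLinePerm m hm i ≠ i := by
  rw [Ne, Fin.ext_iff, oneLinePerm_val]
  unfold oneLine
  split_ifs <;> omega

lemma oneLinePerm_cycleOf_cycleType (hodd : Odd m) (i : Fin (2 * m)) :
    ((oneLinePerm m hm).cycleOf i).cycleType = {m} := by
  rw [(Perm.isCycle_cycleOf _ (oneLinePerm_apply_ne hm i)).cycleType]
  congr 1
  refine Eq.trans ?_ (card_filter_val_mod_two_eq m ((i : ℕ) % 2) (by omega))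
  congr 1
  ext j
  rw [Perm.mem_support_cycleOf_iff' (oneLinePerm_apply_ne hm i), oneLinePerm_sameCycle_iff hm hodd]
  simp [eq_comm]

lemma oneLinePerm_cycleType (hodd : Odd m) : (oneLinePerm m hm).cycleType = {m, m} := by
  set σ := oneLinePerm m hm with hσ
  let a : Fin (2 * m) := ⟨0, by omega⟩
  let b : Fin (2 * m) := ⟨1, by omega⟩
  have hab : ¬ σ.SameCycle a b := by
    rw [oneLinePerm_sameCycle_iff hm hodd]
    simp [a, b]
  have hcover (x) : σ.SameCycle a x ∨ σ.SameCycle b x := by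
    simp only [hσ, oneLinePerm_sameCycle_iff hm hodd, a, b]
    omega
  have hdisj : (σ.cycleOf a).Disjoint (σ.cycleOf b) := by
    intro x
    by_cases hx : σ.SameCycle a x
    · exact .inr (Perm.cycleOf_apply_of_not_sameCycle fun h => hab (hx.trans h.symm))
    · exact .inl (Perm.cycleOf_apply_of_not_sameCycle hx)
  have hmul : σ = σ.cycleOf a * σ.cycleOf b := by
    ext x : 1
    rw [Perm.mul_apply]
    by_cases hx : σ.SameCycle a x
    · rw [Perm.cycleOf_apply_of_not_sameCycle fun h => hab (hx.trans h.symm), hx.cycleOf_apply]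
    · have hb := (hcover x).resolve_left hx
      rw [hb.cycleOf_apply, Perm.cycleOf_apply_of_not_sameCycle]
      rwa [Perm.sameCycle_apply_right]
  rw [hmul, hdisj.cycleType_mul, oneLinePerm_cycleOf_cycleType hm hodd,
    oneLinePerm_cycleOf_cycleType hm hodd]
  rfl

lemma oneLinePerm_lt_iff {i j : Fin (2 * m)} (hij : i < j) :
    oneLinePerm m hm i < oneLinePerm m hm j ↔ (i : ℕ) + 1 = m ∨ (j : ℕ) = m :=
  oneLine_lt_oneLine_iff hm hij j.2

lemma exists_isIncSubseq_oneLinePerm_card_eq_two :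
    ∃ s, IsIncSubseq (oneLinePerm m hm) s ∧ s.card = 2 := by
  refine ⟨{⟨m - 1, by omega⟩, ⟨m, by omega⟩}, fun i hi j hj hij => ?_, Finset.card_pair ?_⟩
  · rw [oneLinePerm_lt_iff hm hij]
    simp only [Finset.mem_insert, Finset.mem_singleton, Fin.ext_iff] at hi hj
    omega
  · simp only [Ne, Fin.mk.injEq]
    omega

lemma IsIncSubseq.card_le_two_of_oneLinePerm {s : Finset (Fin (2 * m))}
    (hs : IsIncSubseq (oneLinePerm m hm) s) : s.card ≤ 2 := by
  by_contra! hcard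
  obtain ⟨a, b, c, ha, hb, hc, hab, hac, hbc⟩ := Finset.two_lt_card_iff.1 hcard
  have key (i) (hi : i ∈ s) (j) (hj : j ∈ s) (hij : (i : ℕ) < j) :
      (i : ℕ) + 1 = m ∨ (j : ℕ) = m :=
    (oneLinePerm_lt_iff hm hij).1 (hs i hi j hj hij)
  have h₁ := key a ha b hb
  have h₂ := key b hb a ha
  have h₃ := key a ha c hc
  have h₄ := key c hc a ha
  have h₅ := key b hb c hc
  have h₆ := key c hc b hb
  omega

lemma exists_isDecSubseq_oneLinePerm_card_eq :
    ∃ s, IsDecSubseq (oneLinePerm m hm) s ∧ s.card = 2 * m - 2 := by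
  refine ⟨{⟨m - 1, by omega⟩, ⟨m, by omega⟩}ᶜ, fun i hi j hj hij => ?_, ?_⟩
  · simp only [Finset.mem_compl, Finset.mem_insert, Finset.mem_singleton, Fin.ext_iff] at hi hj
    refine lt_of_le_of_ne (not_lt.1 ?_) ((oneLinePerm m hm).injective.ne hij.ne')
    rw [oneLinePerm_lt_iff hm hij]
    omega
  · rw [Finset.card_compl, Finset.card_pair, Fintype.card_fin]
    simp only [Ne, Fin.mk.injEq]
    omega

lemma IsDecSubseq.card_le_of_oneLinePerm {s : Finset (Fin (2 * m))}
    (hs : IsDecSubseq (oneLinePerm m hm) s) : s.card ≤ 2 * m - 2 := by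
  have key (i j : Fin (2 * m)) (hij : i < j) (h : (i : ℕ) + 1 = m ∨ (j : ℕ) = m) :
      i ∈ sᶜ ∨ j ∈ sᶜ := by
    simp only [Finset.mem_compl]
    by_contra! hmem
    exact (hs i hmem.1 j hmem.2 hij).asymm ((oneLinePerm_lt_iff hm hij).2 h)
  have hcompl : 1 < sᶜ.card := by
    rw [Finset.one_lt_card]
    have h₁ := key ⟨0, by omega⟩ ⟨m, by omega⟩ (Fin.mk_lt_mk.2 (by omega)) (.inr rfl)
    have h₂ := key ⟨m - 1, by omega⟩ ⟨m + 1, by omega⟩ (Fin.mk_lt_mk.2 (by omega))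
      (.inl (by simp only; omega))
    rcases h₁ with h₁ | h₁ <;> rcases h₂ with h₂ | h₂ <;>
      exact ⟨_, h₁, _, h₂, by simp only [Ne, Fin.mk.injEq]; omega⟩
  rw [Finset.card_compl, Fintype.card_fin] at hcompl
  omega

end oneLinePerm

/-- For `n = 2m` with `m ≥ 3` odd, the permutation
`σ = [n-1, n-2, …, m+1, 1, n, m, m-1, …, 2]` (in one-line notation)
is a product of two disjoint cycles each of length `m` (cycle type `(m, m)`),
its longest increasing subsequence has length `2`, and its longest decreasing
subsequence has length `n - 2`. -/
theorem explicit_perm_cycleType_m_m_shape_two_two_ones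
    (n m : ℕ) (hm : 3 ≤ m) (hodd : Odd m) (hn : n = 2 * m) :
    ∃ σ : Perm (Fin n),
      (∀ i : Fin n,
        ((σ i : ℕ) + 1) =
          if (i : ℕ) + 1 ≤ m - 1 then n - ((i : ℕ) + 1)
          else if (i : ℕ) + 1 = m then 1
          else if (i : ℕ) + 1 = m + 1 then n
          else n + 2 - ((i : ℕ) + 1)) ∧
      fullCycleType σ = {m, m} ∧
      ((∃ s, IsIncSubseq σ s ∧ s.card = 2) ∧
        (∀ s, IsIncSubseq σ s → s.card ≤ 2)) ∧
      ((∃ s, IsDecSubseq σ s ∧ s.card = n - 2) ∧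
        (∀ s, IsDecSubseq σ s → s.card ≤ n - 2)) := by
  subst hn
  refine ⟨oneLinePerm m hm, fun i => ?_, ?_,
    ⟨exists_isIncSubseq_oneLinePerm_card_eq_two hm, fun s hs => hs.card_le_two_of_oneLinePerm hm⟩,
    exists_isDecSubseq_oneLinePerm_card_eq hm, fun s hs => hs.card_le_of_oneLinePerm hm⟩
  · rw [oneLinePerm_val]
    unfold oneLine
    split_ifs <;> omega
  · have hsum : 2 * m - Multiset.sum {m, m} = 0 := by
      simp only [Multiset.insert_eq_cons, Multiset.sum_cons, Multiset.sum_singleton]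
      omega
    rw [fullCycleType, oneLinePerm_cycleType hm hodd, hsum, Multiset.replicate_zero, add_zero]
end
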